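/- arXiv:2605.18388 — 3 statements merged into one kernel-verified Lean document; each statement's English description precedes it below -/
import Mathlib

section
/- Suppose the real part of Π is negative definite. Then the Prym theta function θ, as a function from (Fin h → ℂ) to ℂ, is holomorphic, i.e. Differentiable ℂ θ. -/
open Matrix Complex

/-- Entrywise coercion of an integer vector to a complex vector. -/
def intVecC {h : ℕ} (N : Fin h → ℤ) : Fin h → ℂ := fun i => (N i : ℂ)

/-- Entrywise coercion of a real vector to a complex vector. -/
def realVecC {h : ℕ} (b : Fin h → ℝ) : Fin h → ℂ := fun i => (b i : ℂ)

/-- The Prym theta function of the matrix `Pm`. -/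
noncomputable def prymTheta {h : ℕ} (Pm : Matrix (Fin h) (Fin h) ℂ) (z : Fin h → ℂ) : ℂ :=
  ∑' N : Fin h → ℤ,
    Complex.exp ((1/2) * (intVecC N ⬝ᵥ Pm.mulVec (intVecC N)) + intVecC N ⬝ᵥ z)

/-- `Pm` has negative definite real part: the real symmetric matrix of real parts
is negative definite, i.e. its negation is positive definite. -/
def HasNegDefRealPart {h : ℕ} (Pm : Matrix (Fin h) (Fin h) ℂ) : Prop :=
  (-(Matrix.of fun i j => (Pm i j).re)).PosDef

/-- A product of summable nonnegative functions of the separate coordinates is summable on the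
finite product of the index types. -/
theorem summable_pi_prod_of_nonneg {ι κ : Type*} [Fintype ι] {f : ι → κ → ℝ}
    (hf0 : ∀ i k, 0 ≤ f i k) (hf : ∀ i, Summable (f i)) :
    Summable fun N : ι → κ => ∏ i, f i (N i) := by
  classical
  refine summable_of_sum_le (c := ∏ i, ∑' k, f i k)
    (fun N => Finset.prod_nonneg fun i _ => hf0 i _) fun s => ?_
  calc ∑ N ∈ s, ∏ i, f i (N i)
      ≤ ∑ N ∈ Fintype.piFinset fun i => s.image fun N => N i, ∏ i, f i (N i) := by
        refine Finset.sum_le_sum_of_subset_of_nonneg (fun N hN => ?_)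
          fun N _ _ => Finset.prod_nonneg fun i _ => hf0 i _
        exact Fintype.mem_piFinset.2 fun i => Finset.mem_image_of_mem (fun N => N i) hN
    _ = ∏ i, ∑ k ∈ s.image fun N => N i, f i k := (Finset.prod_univ_sum _ _).symm
    _ ≤ ∏ i, ∑' k, f i k :=
        Finset.prod_le_prod (fun i _ => Finset.sum_nonneg fun k _ => hf0 i k)
          fun i _ => (hf i).sum_le_tsum _ fun k _ => hf0 i k

theorem summable_exp_neg_mul_sq_add_mul_abs {a : ℝ} (ha : 0 < a) (b : ℝ) :
    Summable fun n : ℤ => Real.exp (-a * (n : ℝ) ^ 2 + b * |(n : ℝ)|) := by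
  refine (summable_pow_mul_jacobiTheta₂_term_bound (b / (2 * Real.pi))
    (div_pos ha Real.pi_pos) 0).congr fun n => ?_
  have := Real.pi_ne_zero
  rw [pow_zero, one_mul]
  congr 1
  push_cast
  field_simp
  ring

/-- A positive definite real quadratic form dominates a multiple of the sum of squares. -/
theorem Matrix.PosDef.exists_pos_mul_sum_sq_le {ι : Type*} [Fintype ι] {A : Matrix ι ι ℝ}
    (hA : A.PosDef) : ∃ c : ℝ, 0 < c ∧ ∀ x : ι → ℝ, c * ∑ i, x i ^ 2 ≤ x ⬝ᵥ A *ᵥ x := by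
  have hcont : Continuous fun x : ι → ℝ => x ⬝ᵥ A *ᵥ x := by fun_prop
  obtain ⟨m, hm, hle⟩ := (isCompact_sphere (0 : ι → ℝ) 1).exists_forall_le'
    (a := 0) hcont.continuousOn fun x hx => by
      have hx0 : x ≠ 0 := by
        rintro rfl
        simp at hx
      simpa using hA.re_dotProduct_pos hx0
  have hnorm : ∀ x : ι → ℝ, m * ‖x‖ ^ 2 ≤ x ⬝ᵥ A *ᵥ x := fun x => by
    rcases eq_or_ne x 0 with rfl | hx
    · simp
    have hx' : ‖x‖ ≠ 0 := norm_ne_zero_iff.2 hx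
    have h := hle (‖x‖⁻¹ • x) (by simp [norm_smul, hx'])
    simp only [mulVec_smul, smul_dotProduct, dotProduct_smul, smul_eq_mul] at h
    calc m * ‖x‖ ^ 2 ≤ (‖x‖⁻¹ * (‖x‖⁻¹ * (x ⬝ᵥ A *ᵥ x))) * ‖x‖ ^ 2 := by gcongr
      _ = x ⬝ᵥ A *ᵥ x := by field_simp
  refine ⟨m / (Fintype.card ι + 1), by positivity, fun x => le_trans ?_ (hnorm x)⟩
  have hsum : ∑ i, x i ^ 2 ≤ (Fintype.card ι + 1) * ‖x‖ ^ 2 := by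
    calc ∑ i, x i ^ 2 ≤ ∑ _i : ι, ‖x‖ ^ 2 := Finset.sum_le_sum fun i _ => by
          rw [← sq_abs]
          gcongr
          exact norm_le_pi_norm x i
      _ = Fintype.card ι * ‖x‖ ^ 2 := by simp
      _ ≤ (Fintype.card ι + 1) * ‖x‖ ^ 2 := by gcongr; linarith
  calc m / (Fintype.card ι + 1) * ∑ i, x i ^ 2
      ≤ m / (Fintype.card ι + 1) * ((Fintype.card ι + 1) * ‖x‖ ^ 2) := by gcongr
    _ = m * ‖x‖ ^ 2 := by field_simp

theorem re_intVecC_dotProduct_mulVec {h : ℕ} (Pm : Matrix (Fin h) (Fin h) ℂ) (N : Fin h → ℤ) :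
    (intVecC N ⬝ᵥ Pm *ᵥ intVecC N).re =
      -((fun i => (N i : ℝ)) ⬝ᵥ (-(Matrix.of fun i j => (Pm i j).re)) *ᵥ fun i => (N i : ℝ)) := by
  simp [intVecC, dotProduct, mulVec, Finset.mul_sum, Complex.mul_re]

theorem norm_intVecC_dotProduct_le {h : ℕ} (N : Fin h → ℤ) (z : Fin h → ℂ) :
    ‖intVecC N ⬝ᵥ z‖ ≤ (∑ i, |(N i : ℝ)|) * ‖z‖ := by
  rw [Finset.sum_mul]
  refine norm_sum_le_of_le _ fun i _ => ?_
  rw [norm_mul, intVecC, Complex.norm_intCast]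
  gcongr
  exact norm_le_pi_norm z i

/-- The linear form `z ↦ N ⬝ᵥ z` as a continuous linear map. -/
noncomputable def intVecCForm {h : ℕ} (N : Fin h → ℤ) : (Fin h → ℂ) →L[ℂ] ℂ :=
  LinearMap.mkContinuous (dotProductBilin ℂ ℂ (intVecC N)) (∑ i, |(N i : ℝ)|)
    (norm_intVecC_dotProduct_le N)

theorem norm_intVecCForm_le {h : ℕ} (N : Fin h → ℤ) : ‖intVecCForm N‖ ≤ ∑ i, |(N i : ℝ)| :=
  LinearMap.mkContinuous_norm_le _ (Finset.sum_nonneg fun _ _ => abs_nonneg _) _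

/-- The general term of the Prym theta series is bounded on balls by a product of
one-dimensional Gaussian terms. -/
theorem norm_exp_prymTheta_term_le {h : ℕ} {Pm : Matrix (Fin h) (Fin h) ℂ} {c R : ℝ}
    (hc : ∀ x : Fin h → ℝ,
      c * ∑ i, x i ^ 2 ≤ x ⬝ᵥ (-(Matrix.of fun i j => (Pm i j).re)) *ᵥ x)
    (N : Fin h → ℤ) {z : Fin h → ℂ} (hz : ‖z‖ ≤ R) :
    ‖Complex.exp ((1/2) * (intVecC N ⬝ᵥ Pm.mulVec (intVecC N)) + intVecC N ⬝ᵥ z)‖ ≤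
      Real.exp (-(c / 2) * ∑ i, (N i : ℝ) ^ 2 + R * ∑ i, |(N i : ℝ)|) := by
  rw [Complex.norm_exp, Real.exp_le_exp, Complex.add_re]
  have hhalf : ((1 / 2 : ℂ) * (intVecC N ⬝ᵥ Pm *ᵥ intVecC N)).re =
      1 / 2 * (intVecC N ⬝ᵥ Pm *ᵥ intVecC N).re := by
    simp [Complex.mul_re]
  have hlin : (intVecC N ⬝ᵥ z).re ≤ (∑ i, |(N i : ℝ)|) * R :=
    (Complex.re_le_norm _).trans <| (norm_intVecC_dotProduct_le N z).trans <| by gcongr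
  rw [hhalf, re_intVecC_dotProduct_mulVec]
  linarith [hc fun i => (N i : ℝ)]

theorem summable_exp_neg_mul_sum_sq_add {h : ℕ} {a : ℝ} (ha : 0 < a) (b : ℝ) :
    Summable fun N : Fin h → ℤ =>
      Real.exp (-a * ∑ i, (N i : ℝ) ^ 2 + b * ∑ i, |(N i : ℝ)|) := by
  refine (summable_pi_prod_of_nonneg (fun (_ : Fin h) _ => (Real.exp_pos _).le)
    fun _ => summable_exp_neg_mul_sq_add_mul_abs ha b).congr fun N => ?_
  rw [← Real.exp_sum, Finset.sum_add_distrib, Finset.mul_sum, Finset.mul_sum]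

/-- if the real part of `Pm` is negative definite, the Prym theta
function is holomorphic on `Fin h → ℂ`. -/
theorem prymTheta_differentiable {h : ℕ} (Pm : Matrix (Fin h) (Fin h) ℂ)
    (hsymm : Pm.IsSymm) (hneg : HasNegDefRealPart Pm) :
    Differentiable ℂ (prymTheta Pm) := by
  obtain ⟨c, hc0, hc⟩ := Matrix.PosDef.exists_pos_mul_sum_sq_le hneg
  intro z
  set R : ℝ := ‖z‖ + 1
  have hR : 0 < R := by positivity
  refine (hasFDerivAt_tsum_of_isPreconnected (𝕜 := ℂ) (s := Metric.ball 0 R) (x₀ := 0)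
    (f' := fun N w => Complex.exp ((1/2) * (intVecC N ⬝ᵥ Pm.mulVec (intVecC N)) +
      intVecC N ⬝ᵥ w) • intVecCForm N)
    (summable_exp_neg_mul_sum_sq_add (h := h) (half_pos hc0) (R + 1)) Metric.isOpen_ball
    (convex_ball (0 : Fin h → ℂ) R).isPreconnected (fun N w _ => ?_) (fun N w hw => ?_)
    (Metric.mem_ball_self hR) ?_ ?_).differentiableAt
  · exact ((intVecCForm N).hasFDerivAt.const_add _).cexp
  · have hw' : ‖w‖ ≤ R := (mem_ball_zero_iff.1 hw).le
    rw [norm_smul]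
    calc _ ≤ Real.exp (-(c / 2) * ∑ i, (N i : ℝ) ^ 2 + R * ∑ i, |(N i : ℝ)|) *
          Real.exp (∑ i, |(N i : ℝ)|) := by
            gcongr
            · exact norm_exp_prymTheta_term_le hc N hw'
            · exact (norm_intVecCForm_le N).trans
                ((le_add_of_nonneg_right zero_le_one).trans (Real.add_one_le_exp _))
      _ = _ := by
        rw [← Real.exp_add]
        ring_nf
  · exact (summable_exp_neg_mul_sum_sq_add (half_pos hc0) R).of_norm_bounded
      fun N => norm_exp_prymTheta_term_le hc N (by simpa using hR.le)
  · simp [R]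
end

section
/- The Prym theta function is quasiperiodic with respect to the lattice ℤ(2πiE, Π): for all K M : Fin h → ℤ and all z : Fin h → ℂ, θ(z + 2πi·K + Π.mulVec M) = Complex.exp (-(1/2) * (M ⬝ᵥ Π.mulVec M) - M ⬝ᵥ z) * θ(z), where integer vectors are coerced entrywise to ℂ. -/
open Matrix Complex

theorem intVecC_add {h : ℕ} (N M : Fin h → ℤ) : intVecC (N + M) = intVecC N + intVecC M := by
  ext i
  simp [intVecC]

theorem intVecC_dotProduct_intVecC {h : ℕ} (N K : Fin h → ℤ) :
    intVecC N ⬝ᵥ intVecC K = ((N ⬝ᵥ K : ℤ) : ℂ) := by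
  simp [intVecC, dotProduct]

theorem Matrix.IsSymm.dotProduct_mulVec_comm {n R : Type*} [Fintype n] [CommSemiring R]
    {A : Matrix n n R} (hA : A.IsSymm) (v w : n → R) :
    v ⬝ᵥ A *ᵥ w = w ⬝ᵥ A *ᵥ v := by
  rw [dotProduct_mulVec, ← mulVec_transpose, hA.eq, dotProduct_comm]

/-- quasiperiodicity of the Prym theta function with respect to the
lattice `ℤ(2πiE, Π)`. -/
theorem prymTheta_quasiperiodic {h : ℕ} (Pm : Matrix (Fin h) (Fin h) ℂ)
    (hsymm : Pm.IsSymm) (hneg : HasNegDefRealPart Pm)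
    (K M : Fin h → ℤ) (z : Fin h → ℂ) :
    prymTheta Pm (z + (2 * Real.pi * Complex.I) • intVecC K + Pm.mulVec (intVecC M)) =
      Complex.exp (-(1/2) * (intVecC M ⬝ᵥ Pm.mulVec (intVecC M)) - intVecC M ⬝ᵥ z) *
        prymTheta Pm z := by
  unfold prymTheta
  rw [← tsum_mul_left]
  conv_rhs => rw [← (Equiv.addRight M).tsum_eq]
  refine tsum_congr fun N => ?_
  rw [← Complex.exp_add, Complex.exp_eq_exp_iff_exists_int]
  refine ⟨N ⬝ᵥ K, ?_⟩
  simp only [Equiv.coe_addRight, intVecC_add, mulVec_add, dotProduct_add, add_dotProduct,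
    dotProduct_smul, smul_eq_mul, intVecC_dotProduct_intVecC,
    hsymm.dotProduct_mulVec_comm (intVecC M) (intVecC N)]
  ring
end

section
/- Let b : Fin h → ℝ with b j ∈ {0, 1/2} for every j, define θ̂(z) = θ(z + 2πi·b), and let M : Fin h → ℤ be such that M j is even for every index j with b j = 1/2. Then for all a u v : Fin h → ℂ, θ̂(a + Π.mulVec M + v) * θ(a + u) = Complex.exp (M ⬝ᵥ (u - v)) * θ̂(a + v) * θ(a + Π.mulVec M + u). Equivalently, the ratio θ̂(a + v)/θ(a + u) transforms under a ↦ a + ΠM by the same multiplier exp(-Mᵀ(v-u)) as the ratio θ(a + v)/θ(a + u); this is the invariance of the theta-quotient in the Baker–Akhiezer representation of Lemma 4 and Proposition 1 of the paper under change of the integration path. -/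
open Matrix Complex

/-- Quasi-periodicity of the Prym theta function under `z ↦ z + ΠM`. -/
theorem prymTheta_add_mulVec {h : ℕ} {Pm : Matrix (Fin h) (Fin h) ℂ} (hsymm : Pm.IsSymm)
    (M : Fin h → ℤ) (z : Fin h → ℂ) :
    prymTheta Pm (z + Pm.mulVec (intVecC M)) =
      Complex.exp (-((1/2) * (intVecC M ⬝ᵥ Pm.mulVec (intVecC M))) - intVecC M ⬝ᵥ z) *
        prymTheta Pm z := by
  have hcomm (x y : Fin h → ℂ) : x ⬝ᵥ Pm.mulVec y = y ⬝ᵥ Pm.mulVec x := by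
    rw [dotProduct_mulVec, ← mulVec_transpose, hsymm.eq, dotProduct_comm]
  have hadd (N : Fin h → ℤ) : intVecC (N + M) = intVecC N + intVecC M := by
    ext i
    simp [intVecC]
  unfold prymTheta
  rw [← tsum_mul_left, ← (Equiv.addRight M).tsum_eq
    (fun N => Complex.exp _ * Complex.exp (_ + intVecC N ⬝ᵥ z))]
  refine tsum_congr fun N => ?_
  rw [← Complex.exp_add, Equiv.coe_addRight, hadd]
  congr 1
  simp only [mulVec_add, dotProduct_add, add_dotProduct]
  rw [hcomm (intVecC M) (intVecC N)]
  ring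

/-- A half-integer characteristic pairs trivially with integer vectors that are even on its
support. -/
theorem exp_intVecC_dotProduct_halfPeriod {h : ℕ} {b : Fin h → ℝ}
    (hb : ∀ j, b j = 0 ∨ b j = 1/2) {M : Fin h → ℤ} (hM : ∀ j, b j = 1/2 → Even (M j)) :
    Complex.exp (intVecC M ⬝ᵥ ((2 * Real.pi * Complex.I) • realVecC b)) = 1 := by
  rw [dotProduct, Complex.exp_sum]
  refine Finset.prod_eq_one fun j _ => ?_
  rcases hb j with hj | hj
  · simp [realVecC, hj]
  · obtain ⟨k, hk⟩ := hM j hj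
    rw [Complex.exp_eq_one_iff]
    refine ⟨k, ?_⟩
    simp only [intVecC, realVecC, Pi.smul_apply, smul_eq_mul, hj, hk]
    push_cast
    ring

/-- invariance of the theta-quotient in the Baker--Akhiezer
representation under the shift `a ↦ a + ΠM`: the ratio `θ̂(a+v)/θ(a+u)`
transforms by the same multiplier `exp(-Mᵀ(v-u))` as `θ(a+v)/θ(a+u)`. -/
theorem prymTheta_quotient_invariance {h : ℕ} (Pm : Matrix (Fin h) (Fin h) ℂ)
    (hsymm : Pm.IsSymm) (hneg : HasNegDefRealPart Pm) (b : Fin h → ℝ)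
    (hb : ∀ j, b j = 0 ∨ b j = 1/2)
    (M : Fin h → ℤ) (hM : ∀ j, b j = 1/2 → Even (M j))
    (a u v : Fin h → ℂ) :
    prymTheta Pm (a + Pm.mulVec (intVecC M) + v + (2 * Real.pi * Complex.I) • realVecC b) *
        prymTheta Pm (a + u) =
      Complex.exp (intVecC M ⬝ᵥ (u - v)) *
        prymTheta Pm (a + v + (2 * Real.pi * Complex.I) • realVecC b) *
        prymTheta Pm (a + Pm.mulVec (intVecC M) + u) := by
  have hhat : a + Pm.mulVec (intVecC M) + v + (2 * Real.pi * Complex.I) • realVecC b =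
      (a + v + (2 * Real.pi * Complex.I) • realVecC b) + Pm.mulVec (intVecC M) := by
    abel
  rw [hhat, add_right_comm a _ u, prymTheta_add_mulVec hsymm, prymTheta_add_mulVec hsymm,
    dotProduct_add _ (a + v), ← sub_sub, Complex.exp_sub _ (intVecC M ⬝ᵥ (_ • realVecC b)),
    exp_intVecC_dotProduct_halfPeriod hb hM, div_one]
  have hmult : -((1/2) * (intVecC M ⬝ᵥ Pm.mulVec (intVecC M))) - intVecC M ⬝ᵥ (a + v) =
      intVecC M ⬝ᵥ (u - v) +
        (-((1/2) * (intVecC M ⬝ᵥ Pm.mulVec (intVecC M))) - intVecC M ⬝ᵥ (a + u)) := by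
    simp only [dotProduct_add, dotProduct_sub]
    ring
  rw [hmult, Complex.exp_add]
  ring
end
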